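/- For every i ≥ 0, the Fibonacci word F_{2i+3} satisfies r_B(F_{2i+3}) ≥ i + 2 and r(F_{2i+3}) = 2. In particular, since |F_{2i+3}| = f_{2i+3} ≤ 2^{2i+3}, this family of strings has r_B = Ω(log n) while r = 2. -/

import Mathlib

open List

variable {α : Type*} [LinearOrder α]

/-- A Lyndon word: nonempty and lexicographically strictly smaller than all of
its proper nonempty suffixes. -/
def IsLyndon (w : List α) : Prop :=
  w ≠ [] ∧ ∀ i, 0 < i → i < w.length → w < w.drop i

/-- `fs` is the Lyndon factorization of `w` (factors listed with multiplicity,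
so a necklace `f_i^{k_i}` contributes `k_i` copies of `f_i`): the factors
concatenate to `w`, each factor is Lyndon, and the sequence of factors is
lexicographically non-increasing. -/
def IsLyndonFactorization (w : List α) (fs : List (List α)) : Prop :=
  fs.flatten = w ∧ (∀ f ∈ fs, IsLyndon f) ∧ fs.Chain' (fun a b => b ≤ a)

/-- All cyclic rotations of `w` (with multiplicity). -/
def rotations (w : List α) : List (List α) :=
  (List.range w.length).map fun i => w.drop i ++ w.take i

/-- The rotation moving the last character of `w` to the front. -/
def rotR (w : List α) : List α :=
  w.drop (w.length - 1) ++ w.take (w.length - 1)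

/-- Number of maximal runs of equal consecutive characters of `s`. -/
def runCount (s : List α) : ℕ := (s.destutter (· ≠ ·)).length

/-- The Burrows–Wheeler transform: concatenation of the last characters of all
`|w|` cyclic rotations of `w`, listed in lexicographic order. -/
def BWT (w : List α) : List α :=
  (List.insertionSort (· ≤ ·) (rotations w)).flatMap fun r => r.getLast?.toList

/-- The ω-order comparison: `x ≼_ω y` iff `x^∞ ≤ y^∞`, equivalently `xy ≤ yx`. -/
def omegaLE (x y : List α) : Prop := x ++ y ≤ y ++ x

instance : DecidableRel (omegaLE (α := α)) := fun x y =>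
  inferInstanceAs (Decidable (x ++ y ≤ y ++ x))

/-- The bijective Burrows–Wheeler transform, expressed in terms of the Lyndon
factorization `fs` of a word: concatenation of the last characters of all
cyclic rotations of all Lyndon factors (with multiplicity), listed in ω-order. -/
def BBWTof (fs : List (List α)) : List α :=
  (List.insertionSort omegaLE (fs.flatMap rotations)).flatMap fun r => r.getLast?.toList

/-- The Fibonacci words over the alphabet `{a, b}` with `a ≺ b`, encoded over
`Bool` with `a = false` and `b = true`: `F_0 = b`, `F_1 = a`, `F_i = F_{i-1} F_{i-2}`. -/
def fibWord : ℕ → List Bool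
  | 0 => [true]
  | 1 => [false]
  | (n + 2) => fibWord (n + 1) ++ fibWord n

/-! ### Strict comparison at a first difference -/

/-- `x` is smaller than `y` because of a first differing letter. -/
def Diff (x y : List Bool) : Prop :=
  ∃ p s t, x = p ++ false :: s ∧ y = p ++ true :: t

theorem Diff.append {x y : List Bool} (h : Diff x y) (u v : List Bool) :
    Diff (x ++ u) (y ++ v) := by
  obtain ⟨p, s, t, rfl, rfl⟩ := h
  exact ⟨p, s ++ u, t ++ v, by simp, by simp⟩

theorem Diff.prepend {x y : List Bool} (h : Diff x y) (u : List Bool) :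
    Diff (u ++ x) (u ++ y) := by
  obtain ⟨p, s, t, rfl, rfl⟩ := h
  exact ⟨u ++ p, s, t, by simp, by simp⟩

theorem Diff.lt {x y : List Bool} (h : Diff x y) : x < y := by
  obtain ⟨p, s, t, rfl, rfl⟩ := h
  apply List.append_left_lt
  rw [List.cons_lt_cons_iff]
  left; decide

theorem lt_cases {x y : List Bool} (h : x < y) : Diff x y ∨ ∃ z, z ≠ [] ∧ y = x ++ z := by
  induction x generalizing y with
  | nil =>
    right
    refine ⟨y, ?_, by simp⟩
    rintro rfl
    simp at h
  | cons a x ih =>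
    cases y with
    | nil => simp at h
    | cons b y =>
      rw [List.cons_lt_cons_iff] at h
      rcases h with h | ⟨rfl, h⟩
      · left
        refine ⟨[], x, y, ?_, ?_⟩ <;> revert h <;> cases a <;> cases b <;> simp
      · rcases ih h with h | ⟨z, hz, rfl⟩
        · left; simpa using h.prepend [a]
        · right; exact ⟨z, hz, by simp⟩

/-! ### Lyndon words -/

theorem IsLyndon.append_lt_right {u v : List Bool} (hu : IsLyndon u) (hv : IsLyndon v)
    (h : u < v) : u ++ v < v := by
  rcases lt_cases h with h | ⟨z, hz, rfl⟩
  · have := h.append v []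
    simpa using this.lt
  · apply List.append_left_lt
    have h1 : 0 < u.length := List.length_pos_iff.mpr hu.1
    have h2 : 0 < z.length := List.length_pos_iff.mpr hz
    have := hv.2 u.length h1 (by simp; omega)
    simpa using this

theorem IsLyndon.append {u v : List Bool} (hu : IsLyndon u) (hv : IsLyndon v)
    (h : u < v) : IsLyndon (u ++ v) := by
  have key := IsLyndon.append_lt_right hu hv h
  refine ⟨by simp [hu.1], fun i hi hi' => ?_⟩
  rw [List.length_append] at hi'
  rcases lt_trichotomy i u.length with h1 | h1 | h1
  · have := hu.2 i hi h1
    rcases lt_cases this with h2 | ⟨z, hz, h2⟩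
    · rw [List.drop_append_of_le_length h1.le]
      exact (h2.append v v).lt
    · have := congrArg List.length h2
      simp at this
      omega
  · subst h1
    simpa using key
  · have h3 : (u ++ v).drop i = v.drop (i - u.length) := by
      rw [List.drop_append, List.drop_eq_nil_of_le h1.le, List.nil_append]
    rw [h3]
    exact lt_trans key (hv.2 _ (by omega) (by omega))

theorem exists_border_factor (gs : List (List Bool)) (q : List Bool) (hq : q ≠ [])
    (h : q <+: gs.flatten) : ∃ s, s ≠ [] ∧ s <:+ q ∧ ∃ g ∈ gs, s <+: g := by
  induction gs generalizing q with
  | nil => simp at h; exact absurd h hq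
  | cons g gs ih =>
    rw [List.flatten_cons] at h
    rcases le_or_gt q.length g.length with h1 | h1
    · exact ⟨q, hq, List.suffix_refl _, g, by simp,
        List.prefix_of_prefix_length_le h (List.prefix_append _ _) h1⟩
    · obtain ⟨q', rfl⟩ := List.prefix_of_prefix_length_le (List.prefix_append g gs.flatten) h h1.le
      rw [List.prefix_append_right_inj] at h
      obtain ⟨s, hs, hs1, g', hg', hs2⟩ := ih q' (by rintro rfl; simp at h1) h
      exact ⟨s, hs, hs1.trans (List.suffix_append _ _), g', by simp [hg'], hs2⟩

theorem prefix_le {x y : List Bool} (h : x <+: y) : x ≤ y := by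
  obtain ⟨z, rfl⟩ := h
  cases z with
  | nil => simp
  | cons b z =>
    have := List.append_left_lt (l₁ := x) (l₂ := []) (l₃ := b :: z) (by simp)
    rw [List.append_nil] at this
    exact this.le

theorem lyndon_prefix_le (f g : List Bool) (gs : List (List Bool)) (hf : IsLyndon f)
    (hc : ∀ h ∈ gs, h ≤ g) (hg : g ≠ []) (h : f <+: g ++ gs.flatten) :
    f.length ≤ g.length := by
  by_contra! hlt
  obtain ⟨q, rfl⟩ := List.prefix_of_prefix_length_le (List.prefix_append g gs.flatten) h hlt.le
  rw [List.prefix_append_right_inj] at h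
  obtain ⟨s, hs, ⟨r, rfl⟩, g', hg', hs2⟩ :=
    exists_border_factor gs q (by rintro rfl; simp at hlt) h
  have h1 : 0 < s.length := List.length_pos_iff.mpr hs
  have h2 : 0 < g.length := List.length_pos_iff.mpr hg
  have := hf.2 (g ++ r).length (by simp; omega) (by simp; omega)
  rw [← List.append_assoc, List.drop_left] at this
  have h3 : s ≤ g' := prefix_le hs2
  have h4 : g' ≤ g := hc _ hg'
  have h5 : g ≤ g ++ r ++ s := by
    rw [List.append_assoc]; exact prefix_le (List.prefix_append g (r ++ s))
  exact absurd (lt_of_lt_of_le this (h3.trans (h4.trans h5))) (lt_irrefl _)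

theorem lyndon_unique (fs gs : List (List Bool)) (hf : ∀ f ∈ fs, IsLyndon f)
    (hg : ∀ f ∈ gs, IsLyndon f) (hfc : fs.Pairwise (fun a b => b ≤ a))
    (hgc : gs.Pairwise (fun a b => b ≤ a)) (h : fs.flatten = gs.flatten) : fs = gs := by
  induction fs generalizing gs with
  | nil =>
    cases gs with
    | nil => rfl
    | cons g gs =>
      have := (hg g (by simp)).1
      simp at h
      exact absurd h.1 this
  | cons f fs ih =>
    cases gs with
    | nil =>
      have := (hf f (by simp)).1
      simp at h
      exact absurd h.1 this
    | cons g gs =>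
      rw [List.pairwise_cons] at hfc hgc
      rw [List.flatten_cons, List.flatten_cons] at h
      have l1 := hf f (by simp)
      have l2 := hg g (by simp)
      have a1 := lyndon_prefix_le f g gs l1 hgc.1 l2.1 (h ▸ List.prefix_append _ _)
      have a2 := lyndon_prefix_le g f fs l2 hfc.1 l1.1 (h ▸ List.prefix_append _ _)
      obtain ⟨rfl, h'⟩ := List.append_inj h (le_antisymm a1 a2)
      rw [ih gs (fun x hx => hf x (by simp [hx])) (fun x hx => hg x (by simp [hx])) hfc.2 hgc.2 h']

/-! ### The Lyndon factors -/

/-- The pair of words `(u_k, v_k)`. -/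
def uv : ℕ → List Bool × List Bool
  | 0 => ([false], [true])
  | (k + 1) => ((uv k).1 ++ ((uv k).1 ++ (uv k).2), (uv k).1 ++ (uv k).2)

theorem uv_lyndon (k : ℕ) : IsLyndon (uv k).1 ∧ IsLyndon (uv k).2 ∧ (uv k).1 < (uv k).2 := by
  induction k with
  | zero =>
    refine ⟨⟨by simp [uv], fun i h h' => ?_⟩, ⟨by simp [uv], fun i h h' => ?_⟩, by decide⟩ <;>
    · simp [uv] at h'; omega
  | succ k ih =>
    obtain ⟨h1, h2, h3⟩ := ih
    have h4 := IsLyndon.append h1 h2 h3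
    have h5 : (uv k).1 < (uv k).1 ++ (uv k).2 := by
      have := List.append_left_lt (l₁ := (uv k).1) (l₂ := []) (l₃ := (uv k).2) (by
        have := h2.1
        cases h : (uv k).2 with
        | nil => exact absurd h this
        | cons a l => simp)
      simpa using this
    exact ⟨IsLyndon.append h1 h4 h5, h4,
      List.append_left_lt (IsLyndon.append_lt_right h1 h2 h3)⟩

theorem uv_dec (k : ℕ) : (uv (k + 1)).2 < (uv k).2 :=
  IsLyndon.append_lt_right (uv_lyndon k).1 (uv_lyndon k).2.1 (uv_lyndon k).2.2

theorem fib_step (n : ℕ) : fibWord (n + 2) = fibWord (n + 1) ++ fibWord n := rfl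

theorem uv_fib (k : ℕ) : (uv k).1 ++ [false] = false :: fibWord (2 * k + 1) ∧
    (uv (k + 1)).2 ++ [false] = false :: (fibWord (2 * k) ++ fibWord (2 * k + 1)) := by
  induction k with
  | zero => decide
  | succ k ih =>
    obtain ⟨h1, h2⟩ := ih
    have e1 : 2 * (k + 1) = 2 * k + 2 := by ring
    have a1 : (uv (k + 1)).1 ++ [false] = false :: fibWord (2 * (k + 1) + 1) := by
      have : (uv (k + 1)).1 = (uv k).1 ++ (uv (k + 1)).2 := rfl
      rw [this, List.append_assoc, h2, e1, fib_step (2 * k + 1), fib_step (2 * k)]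
      have : (uv k).1 ++ false :: (fibWord (2 * k) ++ fibWord (2 * k + 1))
        = ((uv k).1 ++ [false]) ++ (fibWord (2 * k) ++ fibWord (2 * k + 1)) := by simp
      rw [this, h1]
      simp
    refine ⟨a1, ?_⟩
    have : (uv (k + 1 + 1)).2 = (uv (k + 1)).1 ++ (uv (k + 1)).2 := rfl
    rw [this, List.append_assoc, h2]
    have : (uv (k + 1)).1 ++ false :: (fibWord (2 * k) ++ fibWord (2 * k + 1))
        = ((uv (k + 1)).1 ++ [false]) ++ (fibWord (2 * k) ++ fibWord (2 * k + 1)) := by simp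
    rw [this, a1, e1, fib_step (2 * k + 1), fib_step (2 * k)]
    simp

/-- The factors `v_1, ..., v_{n}`. -/
def vs (n : ℕ) : List (List Bool) := (List.range n).map fun k => (uv (k + 1)).2

theorem vs_flatten (i : ℕ) : (vs (i + 1) ++ [[false]]).flatten = fibWord (2 * i + 3) := by
  induction i with
  | zero => decide
  | succ i ih =>
    have h2 := (uv_fib (i + 1)).2
    have e : vs (i + 1 + 1) = vs (i + 1) ++ [(uv (i + 1 + 1)).2] := by
      simp [vs, List.range_succ]
    have : (vs (i + 1 + 1) ++ [[false]]).flatten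
      = (vs (i + 1)).flatten ++ ((uv (i + 1 + 1)).2 ++ [false]) := by
      rw [e]; simp
    rw [this, h2]
    have e2 : 2 * (i + 1) = 2 * i + 2 := by ring
    have e3 : 2 * (i + 1) + 3 = 2 * i + 3 + 2 := by ring
    rw [e3, fib_step, fib_step (2 * i + 2), ← ih, e2]
    rw [show 2 * i + 2 + 1 = 2 * i + 3 by ring, ← ih]
    simp

theorem uv_antitone : Antitone (fun k => (uv k).2) :=
  antitone_nat_of_succ_le fun k => (uv_dec k).le

theorem vs_pairwise (n : ℕ) : (vs n ++ [[false]]).Pairwise (fun a b => b ≤ a) := by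
  rw [List.pairwise_append]
  refine ⟨?_, by simp, ?_⟩
  · rw [vs, List.pairwise_map]
    refine List.pairwise_lt_range.imp fun h => ?_
    exact uv_antitone (by omega)
  · intro a ha b hb
    simp [vs] at ha hb
    obtain ⟨k, -, rfl⟩ := ha
    subst hb
    have h2 := (uv_fib k).2
    have h1 := (uv_lyndon (k + 1)).2.1.1
    cases h : (uv (k + 1)).2 with
    | nil => exact absurd h h1
    | cons c l =>
      rw [h] at h2
      simp at h2
      rw [h2.1]
      exact prefix_le ⟨l, rfl⟩

theorem vs_lyndon (n : ℕ) : ∀ f ∈ vs n ++ [[false]], IsLyndon f := by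
  intro f hf
  simp [vs] at hf
  rcases hf with ⟨k, -, rfl⟩ | rfl
  · exact (uv_lyndon _).2.1
  · exact (uv_lyndon 0).1

theorem factorization_eq (i : ℕ) (fs : List (List Bool))
    (h : IsLyndonFactorization (fibWord (2 * i + 3)) fs) : fs = vs (i + 1) ++ [[false]] := by
  obtain ⟨h1, h2, h3⟩ := h
  refine lyndon_unique _ _ h2 (vs_lyndon _) ?_ (vs_pairwise _) (h1.trans (vs_flatten i).symm)
  have : IsTrans (List Bool) (fun a b => b ≤ a) := ⟨fun a b c h h' => le_trans h' h⟩
  exact List.isChain_iff_pairwise.mp h3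

/-! ### The ω-order via a numerical key -/

/-- Binary value. -/
def bval : List Bool → ℕ
  | [] => 0
  | b :: l => (if b then 1 else 0) * 2 ^ l.length + bval l

theorem bval_lt (l : List Bool) : bval l < 2 ^ l.length := by
  induction l with
  | nil => simp [bval]
  | cons b l ih => cases b <;> simp [bval, pow_succ] <;> omega

theorem bval_append (x y : List Bool) : bval (x ++ y) = bval x * 2 ^ y.length + bval y := by
  induction x with
  | nil => simp [bval]
  | cons b x ih => simp only [List.cons_append, bval, ih, List.length_append]; ring

theorem lt_iff_bval (x y : List Bool) (h : x.length = y.length) : x < y ↔ bval x < bval y := by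
  induction x generalizing y with
  | nil => cases y with
    | nil => simp [bval]
    | cons b y => simp at h
  | cons a x ih => cases y with
    | nil => simp at h
    | cons b y =>
      have h' : x.length = y.length := by simpa using h
      have l1 := bval_lt x
      have l2 := bval_lt y
      rw [List.cons_lt_cons_iff, ih y h']
      rw [h'] at l1
      cases a <;> cases b <;> simp only [bval, h'] <;> simp
      · omega
      · exact ⟨fun h => absurd h (by decide), fun h => by omega⟩

/-- The numerical value of `x^∞`. -/
def key (x : List Bool) : ℚ := bval x / (2 ^ x.length - 1)

theorem pow_pos' (x : List Bool) (h : x ≠ []) : (0 : ℚ) < 2 ^ x.length - 1 := by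
  have : x.length ≠ 0 := by simpa using h
  have := one_lt_pow₀ (one_lt_two (α := ℚ)) this
  linarith

theorem omega_lt_iff (x y : List Bool) (hx : x ≠ []) (hy : y ≠ []) :
    x ++ y < y ++ x ↔ key x < key y := by
  rw [lt_iff_bval _ _ (by simp [add_comm]), bval_append, bval_append, key, key,
    div_lt_div_iff₀ (pow_pos' x hx) (pow_pos' y hy), ← Nat.cast_lt (α := ℚ)]
  push_cast
  constructor <;> intro h <;> linarith

theorem omegaLE_iff (x y : List Bool) (hx : x ≠ []) (hy : y ≠ []) :
    omegaLE x y ↔ key x ≤ key y := by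
  rw [← not_lt, ← omega_lt_iff y x hy hx, not_lt]
  rfl

theorem sort_pairwise (l : List (List Bool)) (h : ∀ x ∈ l, x ≠ []) :
    (l.insertionSort omegaLE).Pairwise (fun a b => key a ≤ key b) := by
  have := List.map_insertionSort (r := omegaLE) (s := (· ≤ ·)) key l
    (fun a ha b hb => omegaLE_iff a b (h a ha) (h b hb))
  rw [← List.pairwise_map (f := key) (R := (· ≤ ·)), this]
  exact List.pairwise_insertionSort _ _

theorem sublist_of_key (L ws : List (List Bool))
    (hL : L.Pairwise (fun a b => key a ≤ key b)) (hw : ws.Pairwise (fun a b => key a < key b))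
    (h : ∀ w ∈ ws, w ∈ L) : ws <+ L := by
  induction L generalizing ws with
  | nil =>
    cases ws with
    | nil => simp
    | cons w ws => exact absurd (h w (by simp)) (by simp)
  | cons x L ih =>
    cases ws with
    | nil => simp
    | cons w ws =>
      rw [List.pairwise_cons] at hL
      have hw' := hw
      rw [List.pairwise_cons] at hw'
      by_cases hx : w = x
      · subst hx
        refine List.Sublist.cons_cons _ (ih ws hL.2 hw'.2 fun v hv => ?_)
        rcases List.mem_cons.mp (h v (by simp [hv])) with rfl | h'
        · exact absurd (hw'.1 _ hv) (lt_irrefl _)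
        · exact h'
      · refine List.Sublist.cons _ (ih _ hL.2 hw fun v hv => ?_)
        have hwL : w ∈ L := by
          rcases List.mem_cons.mp (h w (by simp)) with h' | h'
          · exact absurd h' hx
          · exact h'
        rcases List.mem_cons.mp hv with rfl | hv
        · exact hwL
        rcases List.mem_cons.mp (h v (by simp [hv])) with rfl | h'
        · exact absurd (lt_of_lt_of_le (hw'.1 _ hv) (hL.1 _ hwL)) (lt_irrefl _)
        · exact h'

theorem mem_rotations {w x : List Bool} (hw : w ≠ []) : x ∈ rotations w ↔ w ~r x := by
  simp only [rotations, List.mem_map, List.mem_range]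
  constructor
  · rintro ⟨i, hi, rfl⟩
    exact ⟨i, List.rotate_eq_drop_append_take hi.le⟩
  · intro h
    obtain ⟨n, hn, h⟩ := List.isRotated_iff_mod.mp h
    rcases hn.lt_or_eq with hn | hn
    · exact ⟨n, hn, by rw [← h, List.rotate_eq_drop_append_take hn.le]⟩
    · refine ⟨0, List.length_pos_iff.mpr hw, ?_⟩
      rw [← h, hn]; simp

/-- Witness `A_k`. -/
def wA (k : ℕ) : List Bool := fibWord (2 * k) ++ fibWord (2 * k + 1)
/-- Witness `B_k`. -/
def wB (k : ℕ) : List Bool := fibWord (2 * k + 1) ++ fibWord (2 * k)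

theorem wA_rot (k : ℕ) : (uv (k + 1)).2 ~r wA k := by
  have h2 := (uv_fib k).2
  cases h : (uv (k + 1)).2 with
  | nil => exact absurd h (uv_lyndon (k + 1)).2.1.1
  | cons c l =>
    rw [h] at h2
    simp at h2
    refine ⟨1, ?_⟩
    rw [wA, ← h2.2, h2.1]
    simp

theorem wB_rot (k : ℕ) : (uv (k + 1)).2 ~r wB k :=
  (wA_rot k).trans (List.isRotated_append)

theorem diff_BA (k : ℕ) : Diff (wB k) (wA k) := by
  induction k with
  | zero => exact ⟨[], [true], [false], rfl, rfl⟩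
  | succ k ih =>
    have := ih.prepend (fibWord (2 * k + 2) ++ fibWord (2 * k + 1))
    have e1 : 2 * (k + 1) = 2 * k + 2 := by ring
    simp only [wA, wB, e1, fib_step (2 * k), fib_step (2 * k + 1)] at *
    simpa using this

theorem wA_ne (k : ℕ) : wA k ≠ [] := by
  intro h
  have := (wA_rot k).perm.length_eq
  rw [h] at this
  exact (uv_lyndon (k + 1)).2.1.1 (List.length_eq_zero_iff.mp this)

theorem wB_ne (k : ℕ) : wB k ≠ [] := by
  intro h
  have := (wB_rot k).perm.length_eq
  rw [h] at this
  exact (uv_lyndon (k + 1)).2.1.1 (List.length_eq_zero_iff.mp this)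

theorem key_BA (k : ℕ) : key (wB k) < key (wA k) := by
  rw [← omega_lt_iff _ _ (wB_ne k) (wA_ne k)]
  exact ((diff_BA k).append _ _).lt

theorem key_AB (k : ℕ) : key (wA (k + 1)) < key (wB k) := by
  rw [← omega_lt_iff _ _ (wA_ne _) (wB_ne k)]
  have h := ((diff_BA (k + 1)).prepend (wB k)).lt
  have e1 : 2 * (k + 1) = 2 * k + 2 := by ring
  have e2 : wB k = fibWord (2 * k + 2) := rfl
  have : wA (k + 1) ++ wB k = wB k ++ wB (k + 1) := by
    rw [e2, wA, wB, e1]; simp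
  rw [this]
  exact h

theorem fib_head (n : ℕ) : ∃ l, fibWord (n + 2) = false :: true :: l := by
  induction n with
  | zero => exact ⟨[], rfl⟩
  | succ n ih =>
    obtain ⟨l, hl⟩ := ih
    exact ⟨l ++ fibWord (n + 1), by rw [fib_step (n + 1), hl]; rfl⟩

theorem key_a (k : ℕ) : key [false] < key (wB k) := by
  rw [← omega_lt_iff _ _ (by simp) (wB_ne k)]
  have e2 : wB k = fibWord (2 * k + 2) := rfl
  obtain ⟨l, hl⟩ := fib_head (2 * k)
  rw [e2, hl]
  exact Diff.lt ⟨[false], true :: l, l ++ [false], rfl, rfl⟩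

theorem fib_last (k : ℕ) : (fibWord (2 * k)).getLast? = some true ∧
    (fibWord (2 * k + 1)).getLast? = some false := by
  induction k with
  | zero => decide
  | succ k ih =>
    have e1 : 2 * (k + 1) = 2 * k + 2 := by ring
    rw [e1, fib_step (2 * k + 1), fib_step (2 * k)]
    simp [List.getLast?_append, ih]

theorem wA_last (k : ℕ) : (wA k).getLast? = some false := by
  simp [wA, List.getLast?_append, fib_last]

theorem wB_last (k : ℕ) : (wB k).getLast? = some true := by
  simp [wB, List.getLast?_append, fib_last]

/-- The witnesses. -/
def wit : ℕ → List (List Bool)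
  | 0 => [wB 0, wA 0]
  | (k + 1) => wB (k + 1) :: wA (k + 1) :: wit k

theorem wit_head (k : ℕ) : ∃ l, wit k = wB k :: l := by
  cases k <;> exact ⟨_, rfl⟩

theorem wit_chain (k : ℕ) : (wit k).IsChain (fun a b => key a < key b) := by
  induction k with
  | zero => simp [wit, key_BA]
  | succ k ih =>
    obtain ⟨l, hl⟩ := wit_head k
    rw [wit, hl]
    rw [hl] at ih
    simp [key_BA, key_AB, ih]

theorem wit_pairwise (k : ℕ) : ([false] :: wit k).Pairwise (fun a b => key a < key b) := by
  have : IsTrans (List Bool) (fun a b => key a < key b) := ⟨fun a b c h h' => lt_trans h h'⟩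
  apply List.isChain_iff_pairwise.mp
  obtain ⟨l, hl⟩ := wit_head k
  have ih := wit_chain k
  rw [hl] at ih ⊢
  simp [key_a, ih]

theorem wit_mem (k : ℕ) : ∀ w ∈ wit k, ∃ j ≤ k, w = wA j ∨ w = wB j := by
  induction k with
  | zero => simp [wit]
  | succ k ih =>
    intro w hw
    simp only [wit, List.mem_cons] at hw
    rcases hw with rfl | rfl | hw
    · exact ⟨k + 1, le_rfl, Or.inr rfl⟩
    · exact ⟨k + 1, le_rfl, Or.inl rfl⟩
    · obtain ⟨j, hj, h⟩ := ih w hw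
      exact ⟨j, by omega, h⟩

/-- The last letters of the witnesses. -/
def alt : ℕ → List Bool
  | 0 => [true, false]
  | (k + 1) => true :: false :: alt k

theorem wit_last (k : ℕ) : ((wit k).flatMap fun r => r.getLast?.toList) = alt k := by
  induction k with
  | zero => simp [wit, alt, wA_last, wB_last]
  | succ k ih => simp [wit, alt, wA_last, wB_last, ih]

theorem alt_chain (k : ℕ) : (false :: alt k).IsChain (· ≠ ·) := by
  induction k with
  | zero => decide
  | succ k ih => simp [alt, ih]

theorem alt_length (k : ℕ) : (alt k).length = 2 * k + 2 := by
  induction k with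
  | zero => rfl
  | succ k ih => simp [alt, ih]; ring

theorem flatMap_sublist {l₁ l₂ : List (List Bool)} (h : l₁ <+ l₂) (f : List Bool → List Bool) :
    l₁.flatMap f <+ l₂.flatMap f := by
  induction h with
  | slnil => simp
  | cons a _ ih => exact ih.trans (by simp)
  | cons_cons a _ ih => simpa using ih

theorem bbwt_part (i : ℕ) (fs : List (List Bool))
    (h : IsLyndonFactorization (fibWord (2 * i + 3)) fs) : i + 2 ≤ runCount (BBWTof fs) := by
  rw [factorization_eq i fs h]
  have hne : ∀ x ∈ (vs (i + 1) ++ [[false]]).flatMap rotations, x ≠ [] := by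
    intro x hx
    rw [List.mem_flatMap] at hx
    obtain ⟨f, hf, hx⟩ := hx
    have hf' := (vs_lyndon _ f hf).1
    rw [mem_rotations hf'] at hx
    rintro rfl
    exact hf' (List.isRotated_nil_iff.mp hx)
  have hs := sublist_of_key _ ([false] :: wit i) (sort_pairwise _ hne) (wit_pairwise i) (by
    intro w hw
    rw [List.mem_insertionSort, List.mem_flatMap]
    rcases List.mem_cons.mp hw with rfl | hw
    · exact ⟨[false], by simp, by decide⟩
    · obtain ⟨j, hj, hj'⟩ := wit_mem i w hw
      refine ⟨(uv (j + 1)).2, ?_, ?_⟩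
      · simp only [vs, List.mem_append, List.mem_map, List.mem_range]
        exact Or.inl ⟨j, by omega, rfl⟩
      · rw [mem_rotations (uv_lyndon (j + 1)).2.1.1]
        rcases hj' with rfl | rfl
        · exact wA_rot j
        · exact wB_rot j)
  have hs2 := flatMap_sublist hs (fun r => r.getLast?.toList)
  have e : (([false] :: wit i).flatMap fun r => r.getLast?.toList) = false :: alt i := by
    rw [List.flatMap_cons, wit_last]; rfl
  rw [e] at hs2
  have := List.IsChain.length_le_length_destutter_ne hs2 (alt_chain i)
  rw [List.length_cons, alt_length] at this
  have h3 : 2 * i + 2 + 1 ≤ runCount (BBWTof (vs (i + 1) ++ [[false]])) := by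
    unfold runCount BBWTof
    convert this
  omega

/-! ### The BWT of Fibonacci words -/

/-- The Fibonacci morphism. -/
def phi : List Bool → List Bool
  | [] => []
  | false :: l => false :: true :: phi l
  | true :: l => false :: phi l

theorem phi_append (x y : List Bool) : phi (x ++ y) = phi x ++ phi y := by
  induction x with
  | nil => rfl
  | cons b x ih => cases b <;> simp [phi, ih]

theorem phi_fib (n : ℕ) : phi (fibWord n) = fibWord (n + 1) := by
  induction n using Nat.twoStepInduction with
  | zero => rfl
  | one => rfl
  | more n ih1 ih2 => rw [fib_step, phi_append, ih1, ih2]; rfl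

theorem phi_rotate (w z : List Bool) (h : phi w ~r z) :
    (∃ w', w ~r w' ∧ z = phi w') ∨ ∃ w', w ~r (false :: w') ∧ z = true :: (phi w' ++ [false]) := by
  obtain ⟨n, rfl⟩ := h
  induction n with
  | zero => left; exact ⟨w, List.IsRotated.refl w, by simp⟩
  | succ n ih =>
    rw [← List.rotate_rotate]
    rcases ih with ⟨w', h, e⟩ | ⟨w', h, e⟩ <;> rw [e]
    · rcases w' with _ | ⟨_ | _, l⟩
      · left; exact ⟨[], h, by simp [phi]⟩
      · right; exact ⟨l, h, by simp [phi]⟩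
      · left
        refine ⟨l ++ [true], h.trans ⟨1, by simp⟩, by simp [phi, phi_append]⟩
    · left
      refine ⟨w' ++ [false], h.trans ⟨1, by simp⟩, by simp [phi, phi_append]⟩

/-- Rotations ending in `b` precede those ending in `a`. -/
def Clustered (w : List Bool) : Prop :=
  ∀ x y, w ~r (x ++ [true]) → w ~r (y ++ [false]) → Diff (x ++ [true]) (y ++ [false])

theorem phi_head (l : List Bool) (h : l ≠ []) : ∃ t, phi l = false :: t := by
  rcases l with _ | ⟨_ | _, l⟩
  · exact absurd rfl h
  · exact ⟨_, rfl⟩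
  · exact ⟨_, rfl⟩

theorem clustered_phi (w : List Bool) (h : Clustered w) : Clustered (phi w) := by
  intro x y hx hy
  rcases phi_rotate _ _ hx with ⟨w1, h1, e1⟩ | ⟨w1, h1, e1⟩
  swap
  · have := congrArg List.getLast? e1
    rw [← List.cons_append, List.getLast?_concat, List.getLast?_concat] at this
    simp at this
  rcases List.eq_nil_or_concat w1 with rfl | ⟨q1, c1, rfl⟩
  · simp [phi] at e1
  obtain rfl : c1 = false := by
    cases c1
    · rfl
    · have := congrArg List.getLast? e1
      simp [phi_append, phi] at this
  rcases phi_rotate _ _ hy with ⟨w2, h2, e2⟩ | ⟨w2, h2, e2⟩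
  · rcases List.eq_nil_or_concat w2 with rfl | ⟨q2, c2, rfl⟩
    · simp [phi] at e2
    obtain rfl : c2 = true := by
      cases c2
      · have := congrArg List.getLast? e2
        simp [phi_append, phi] at this
      · rfl
    simp only [List.concat_eq_append] at *
    obtain ⟨p, s, t, ep, et⟩ := h _ _ h2 h1
    have ht : t ≠ [] := by
      rintro rfl
      have := congrArg List.getLast? et
      simp at this
    obtain ⟨t', ht'⟩ := phi_head t ht
    rw [e1, e2, ep, et]
    refine ⟨phi p ++ [false], t', phi s, ?_, ?_⟩
    · simp [phi_append, phi, ht']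
    · simp [phi_append, phi]
  · obtain ⟨t, ht⟩ := phi_head (q1.concat false) (by simp)
    rw [e1, e2, ht]
    exact ⟨[], t, _, rfl, rfl⟩

theorem clustered_fib (n : ℕ) : Clustered (fibWord n) := by
  induction n with
  | zero =>
    intro x y hx hy
    have := hy.mem_iff (a := false)
    simp [fibWord] at this
  | succ n ih => rw [← phi_fib]; exact clustered_phi _ ih

theorem bwt_part (n : ℕ) : runCount (BWT (fibWord (n + 2))) = 2 := by
  obtain ⟨l, hl⟩ := fib_head n
  have hne : fibWord (n + 2) ≠ [] := by rw [hl]; simp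
  set w := fibWord (n + 2) with hw
  have hcl : Clustered w := clustered_fib _
  set L := List.insertionSort (· ≤ ·) (rotations w) with hL
  have hLp : L.Pairwise (· ≤ ·) := List.pairwise_insertionSort _ _
  have hmem : ∀ x, x ∈ L ↔ w ~r x := fun x => by
    rw [hL, List.mem_insertionSort, mem_rotations hne]
  have hB : BWT w = L.flatMap fun r => r.getLast?.toList := rfl
  have hlast : ∀ (r : List Bool) (b : Bool), b ∈ r.getLast?.toList → ∃ x, r = x ++ [b] := by
    intro r b hb
    rcases List.eq_nil_or_concat r with rfl | ⟨q, c, rfl⟩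
    · simp at hb
    · simp at hb; exact ⟨q, by simp [hb]⟩
  have hall : ∀ b : Bool, b ∈ BWT w := by
    intro b
    have hbw : b ∈ w := by rw [hl]; cases b <;> simp
    obtain ⟨s, t, hst⟩ := List.append_of_mem hbw
    rw [hB, List.mem_flatMap]
    refine ⟨t ++ (s ++ [b]), ?_, ?_⟩
    · rw [hmem, hst]
      have : s ++ b :: t = (s ++ [b]) ++ t := by simp
      rw [this]
      exact List.isRotated_append
    · rw [← List.append_assoc]; simp
  have hpw : (BWT w).Pairwise (· ≥ ·) := by
    rw [hB, List.pairwise_flatMap]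
    constructor
    · intro r _
      cases r.getLast? <;> simp
    · refine hLp.imp_of_mem ?_
      intro r1 r2 hr1 hr2 hle b1 hb1 b2 hb2
      obtain ⟨x, rfl⟩ := hlast _ _ hb1
      obtain ⟨y, rfl⟩ := hlast _ _ hb2
      rw [hmem] at hr1 hr2
      cases b1 <;> cases b2 <;> try decide
      exact absurd (hcl _ _ hr2 hr1).lt (not_lt.mpr hle)
  have h1 : runCount (BWT w) = (BWT w).dedup.length := by
    rw [← hpw.destutter_eq_dedup]
    unfold runCount
    congr
  rw [h1, ← List.card_toFinset]
  have : (BWT w).toFinset = Finset.univ := by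
    ext b; simp [hall b]
  rw [this]; rfl

/-- For every `i ≥ 0`, the Fibonacci word `F_{2i+3}` satisfies
`r_B(F_{2i+3}) ≥ i + 2` while `r(F_{2i+3}) = 2`. -/
theorem fibWord_bbwt_runs_large_bwt_runs_two (i : ℕ) :
    (∀ fs, IsLyndonFactorization (fibWord (2 * i + 3)) fs →
      i + 2 ≤ runCount (BBWTof fs)) ∧
    runCount (BWT (fibWord (2 * i + 3))) = 2 := by
  exact ⟨fun fs h => bbwt_part i fs h, bwt_part (2 * i + 1)⟩
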